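/- For every integer n ≥ 2 and every x ≥ 0, φ_n(x) ≤ φ_n'(0) · x = 4x/(4n²-1); equivalently the function x ↦ 4x/(4n²-1) - φ_n(x) is nonnegative on [0,∞). -/

import Mathlib

open Real

/-- The universal function `φ_n`. -/
noncomputable def phi (n : ℕ) (x : ℝ) : ℝ :=
  ∫ η in (0:ℝ)..π, Real.exp (-2 * x * Real.sin η) * Real.cos (2 * n * η)

/-- Differentiation under the integral sign. -/
lemma aux_deriv (w : ℝ → ℝ) (hw : Continuous w) (x₀ : ℝ) :
    HasDerivAt (fun x : ℝ => ∫ η in (0:ℝ)..π, Real.exp (-2 * x * Real.sin η) * w η)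
      (∫ η in (0:ℝ)..π, Real.exp (-2 * x₀ * Real.sin η) * (-2 * Real.sin η * w η)) x₀ := by
  refine (intervalIntegral.hasDerivAt_integral_of_dominated_loc_of_deriv_le
    (F := fun x η => Real.exp (-2 * x * Real.sin η) * w η)
    (F' := fun x η => Real.exp (-2 * x * Real.sin η) * (-2 * Real.sin η * w η))
    (bound := fun η => Real.exp (2 * (|x₀| + 1)) * |(-2 * Real.sin η * w η)|)
    (Metric.ball_mem_nhds x₀ one_pos) ?_ ?_ ?_ ?_ ?_ ?_).2
  · refine Filter.Eventually.of_forall fun x => ?_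
    exact (by fun_prop : Continuous fun η => Real.exp (-2 * x * Real.sin η) * w η).aestronglyMeasurable
  · exact (by fun_prop : Continuous fun η =>
      Real.exp (-2 * x₀ * Real.sin η) * w η).intervalIntegrable _ _
  · exact (by fun_prop : Continuous fun η =>
      Real.exp (-2 * x₀ * Real.sin η) * (-2 * Real.sin η * w η)).aestronglyMeasurable
  · refine Filter.Eventually.of_forall fun η _ x hx => ?_
    rw [norm_mul, Real.norm_eq_abs, Real.norm_eq_abs, Real.abs_exp]
    refine mul_le_mul_of_nonneg_right (Real.exp_le_exp.2 ?_) (abs_nonneg _)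
    have h1 : |x| ≤ |x₀| + 1 := by
      rw [Metric.mem_ball, Real.dist_eq] at hx
      have := abs_sub_abs_le_abs_sub x x₀
      linarith
    have h2 : |x * Real.sin η| ≤ |x| := by
      rw [abs_mul]
      exact mul_le_of_le_one_right (abs_nonneg _) (Real.abs_sin_le_one η)
    have h3 := neg_abs_le (x * Real.sin η)
    linarith
  · exact (by fun_prop : Continuous fun η =>
      Real.exp (2 * (|x₀| + 1)) * |(-2 * Real.sin η * w η)|).intervalIntegrable _ _
  · refine Filter.Eventually.of_forall fun η _ x _ => ?_
    have h : HasDerivAt (fun x : ℝ => -2 * x * Real.sin η) (-2 * 1 * Real.sin η) x :=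
      ((hasDerivAt_id x).const_mul (-2)).mul_const _
    refine (h.exp.mul_const (w η)).congr_deriv ?_
    ring

lemma aux_ode (n : ℕ) (x : ℝ) :
    ∫ η in (0:ℝ)..π, Real.exp (-2 * x * Real.sin η) *
      ((4 * x ^ 2 * Real.cos η ^ 2 + 2 * x * Real.sin η + 4 * (n:ℝ) ^ 2) * Real.cos (2 * n * η))
      = 4 * x := by
  have hc : Real.cos (2 * n * π) = 1 := by
    rw [show (2 * n * π : ℝ) = n * (2 * π) by ring]; exact Real.cos_nat_mul_two_pi n
  have hs : Real.sin (2 * n * π) = 0 := by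
    have := Real.sin_nat_mul_pi (2 * n)
    push_cast at this; exact this
  rw [intervalIntegral.integral_eq_sub_of_hasDerivAt
    (f := fun η => Real.exp (-2 * x * Real.sin η) *
      (-2 * x * Real.cos η * Real.cos (2 * n * η) + 2 * n * Real.sin (2 * n * η)))]
  · simp [hc, hs]; ring
  · intro η _
    have hE : HasDerivAt (fun η : ℝ => Real.exp (-2 * x * Real.sin η))
      (Real.exp (-2 * x * Real.sin η) * (-2 * x * Real.cos η)) η :=
      ((Real.hasDerivAt_sin η).const_mul (-2 * x)).exp
    have hl : HasDerivAt (fun η : ℝ => 2 * (n:ℝ) * η) (2 * n) η := by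
      simpa using (hasDerivAt_id η).const_mul (2 * (n:ℝ))
    have := hE.mul ((((Real.hasDerivAt_cos η).const_mul (-2 * x)).mul hl.cos).add
      (hl.sin.const_mul (2 * (n:ℝ))))
    refine this.congr_deriv ?_
    simp only [Pi.add_apply, Pi.mul_apply]
    ring
  · exact (by fun_prop : Continuous _).intervalIntegrable _ _

/-- First derivative. -/
noncomputable def phi1 (n : ℕ) (x : ℝ) : ℝ :=
  ∫ η in (0:ℝ)..π, Real.exp (-2 * x * Real.sin η) * (-2 * Real.sin η * Real.cos (2 * n * η))

/-- Second derivative. -/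
noncomputable def phi2 (n : ℕ) (x : ℝ) : ℝ :=
  ∫ η in (0:ℝ)..π, Real.exp (-2 * x * Real.sin η) *
    (-2 * Real.sin η * (-2 * Real.sin η * Real.cos (2 * n * η)))

lemma phi_ode (n : ℕ) (x : ℝ) :
    x ^ 2 * phi2 n x + x * phi1 n x - (4 * x ^ 2 + 4 * (n:ℝ) ^ 2) * phi n x = -(4 * x) := by
  rw [← aux_ode n x, phi, phi1, phi2, ← intervalIntegral.integral_const_mul,
    ← intervalIntegral.integral_const_mul, ← intervalIntegral.integral_const_mul,
    ← intervalIntegral.integral_add, ← intervalIntegral.integral_sub,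
    ← intervalIntegral.integral_neg]
  · congr 1
    ext η
    have := Real.sin_sq_add_cos_sq η
    have h2 : Real.cos η ^ 2 = 1 - Real.sin η ^ 2 := by linarith
    rw [h2]; ring
  all_goals exact (by fun_prop : Continuous _).intervalIntegrable _ _

lemma phi_zero (n : ℕ) (hn : 2 ≤ n) : phi n 0 = 0 := by
  have h := phi_ode n 0
  have hn' : (n:ℝ) ≠ 0 := by positivity
  have : 4 * (n:ℝ) ^ 2 * phi n 0 = 0 := by linarith
  simpa [hn'] using this

lemma phi_le (n : ℕ) (x : ℝ) (hx : 0 ≤ x) : phi n x ≤ π := by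
  have h : ‖phi n x‖ ≤ 1 * |π - 0| := by
    refine intervalIntegral.norm_integral_le_of_norm_le_const fun η hη => ?_
    rw [Set.uIoc_of_le Real.pi_pos.le] at hη
    have hs := Real.sin_nonneg_of_nonneg_of_le_pi hη.1.le hη.2
    rw [norm_mul, Real.norm_eq_abs, Real.norm_eq_abs, Real.abs_exp]
    refine mul_le_one₀ (Real.exp_le_one_iff.2 ?_) (abs_nonneg _) (Real.abs_cos_le_one _)
    nlinarith [mul_nonneg hx hs]
  rw [sub_zero, abs_of_pos Real.pi_pos, one_mul] at h
  exact (le_abs_self _).trans h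

/-- For `n ≥ 2` and `x ≥ 0`, `φ_n(x) ≤ φ_n'(0)·x = 4x/(4n²-1)`. -/
theorem stmt_6 (n : ℕ) (hn : 2 ≤ n) (x : ℝ) (hx : 0 ≤ x) :
    phi n x ≤ 4 * x / (4 * (n:ℝ)^2 - 1) := by
  have hn' : (2:ℝ) ≤ n := by exact_mod_cast hn
  have hD : 0 < 4 * (n:ℝ)^2 - 1 := by nlinarith
  obtain ⟨B, hB⟩ : ∃ B, B = 4 / (4 * (n:ℝ)^2 - 1) := ⟨_, rfl⟩
  have hBpos : 0 < B := by rw [hB]; positivity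
  have hBD : B * (4 * (n:ℝ)^2 - 1) = 4 := by rw [hB]; field_simp
  have hBx : 4 * x / (4 * (n:ℝ)^2 - 1) = B * x := by rw [hB]; ring
  rw [hBx]
  by_contra! hlt
  obtain ⟨g, hg⟩ : ∃ g : ℝ → ℝ, g = fun y => phi n y - B * y := ⟨_, rfl⟩
  have hd1 : ∀ y, HasDerivAt g (phi1 n y - B) y := by
    intro y
    have h1 : HasDerivAt (phi n) (phi1 n y) y := aux_deriv _ (by fun_prop) y
    have h2 : HasDerivAt (fun y : ℝ => B * y) B y := by
      simpa using (hasDerivAt_id y).const_mul B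
    rw [hg]; exact h1.sub h2
  have hd2 : ∀ y, HasDerivAt (fun y => phi1 n y - B) (phi2 n y) y := by
    intro y
    have h1 : HasDerivAt (phi1 n) (phi2 n y) y := aux_deriv _ (by fun_prop) y
    exact h1.sub_const B
  have hder : deriv g = fun y => phi1 n y - B := funext fun y => (hd1 y).deriv
  have hder2 : ∀ y, deriv (deriv g) y = phi2 n y := fun y => by
    rw [hder]; exact (hd2 y).deriv
  have hcont : Continuous g := continuous_iff_continuousAt.2 fun y => (hd1 y).continuousAt
  have hgx : 0 < g x := by rw [hg]; simpa using hlt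
  obtain ⟨R, hR⟩ : ∃ R, R = x + π / B := ⟨_, rfl⟩
  have hxR : x ≤ R := by rw [hR]; have := Real.pi_pos; have : 0 < π / B := by positivity
                         linarith
  have hgR : g R ≤ 0 := by
    have h1 := phi_le n R (hx.trans hxR)
    have h2 : B * R = B * x + π := by rw [hR]; field_simp
    have h3 := mul_nonneg hBpos.le hx
    rw [hg]; simp only; linarith
  have hg0 : g 0 = 0 := by rw [hg]; simp [phi_zero n hn]
  obtain ⟨z, hz, hmax⟩ := isCompact_Icc.exists_isMaxOn ⟨x, hx, hxR⟩ hcont.continuousOn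
  have hgz : 0 < g z := hgx.trans_le (hmax ⟨hx, hxR⟩)
  have hz0 : 0 < z := lt_of_le_of_ne hz.1 (by rintro rfl; linarith)
  have hzR : z < R := lt_of_le_of_ne hz.2 (by rintro rfl; linarith)
  have hlm : IsLocalMax g z := hmax.isLocalMax (Icc_mem_nhds hz0 hzR)
  have hz1 : phi1 n z - B = 0 := by
    have := hlm.deriv_eq_zero
    rwa [hder] at this
  have hz2 : 0 < phi2 n z := by
    have ho := phi_ode n z
    have hp1 : phi1 n z = B := by linarith
    have hp : phi n z = g z + B * z := by rw [hg]; simp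
    rw [hp1, hp] at ho
    have key : z ^ 2 * phi2 n z = (4 * z ^ 2 + 4 * (n:ℝ) ^ 2) * g z + 4 * B * z ^ 3 := by
      linear_combination ho + z * hBD
    have : 0 < z ^ 2 * phi2 n z := by rw [key]; positivity
    exact pos_of_mul_pos_right this (by positivity)
  have hmin : IsLocalMin g z := isLocalMin_of_deriv_deriv_pos (by rw [hder2]; exact hz2)
    (by rw [hder]; exact hz1) hcont.continuousAt
  have hconst : g =ᶠ[nhds z] fun _ => g z := by
    filter_upwards [hlm, hmin] with y h1 h2
    exact le_antisymm h1 h2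
  have h0 := hconst.deriv.deriv_eq
  rw [hder2] at h0
  simp at h0
  linarith
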